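/- For every truncation function τ there exists a constant κ > 0, depending only on τ, with the following property: for every Borel measure K on ℝ satisfying ∫_ℝ min(1, y²) K(dy) < ∞, all real numbers b and a, and every c ∈ [−1, 1], one has |c·a·b + ∫_ℝ (τ(c·a·y) − c·a·τ(y)) K(dy)| ≤ |a·b + ∫_ℝ (τ(a·y) − a·τ(y)) K(dy)| + κ · ∫_ℝ min(1, (a·y)²) K(dy). -/

import Mathlib

open MeasureTheory

/-- A truncation function is homogeneous up to a multiple of `min 1 (y ^ 2)`, uniformly for
scaling factors in a bounded set. -/
theorem exists_abs_truncation_mul_sub_le (τ : ℝ → ℝ)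
    (hτ_bdd : ∃ B : ℝ, ∀ u : ℝ, |τ u| ≤ B)
    (hτ_id : ∃ δ > (0 : ℝ), ∀ u : ℝ, |u| ≤ δ → τ u = u) (A : ℝ) (hA : 0 ≤ A) :
    ∃ C > (0 : ℝ), ∀ a : ℝ, |a| ≤ A → ∀ y : ℝ,
      |τ (a * y) - a * τ y| ≤ C * min 1 (y ^ 2) := by
  obtain ⟨B, hB⟩ := hτ_bdd
  obtain ⟨δ, hδ, hid⟩ := hτ_id
  have hB0 : 0 ≤ B := (abs_nonneg _).trans (hB 0)
  have hr : 0 < δ / (1 + A) := by positivity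
  set r := δ / (1 + A) with hr_def
  have hrδ : r * (1 + A) = δ := by rw [hr_def]; field_simp
  have hm : 0 < min 1 (r ^ 2) := lt_min one_pos (by positivity)
  refine ⟨(B * (1 + A) + 1) / min 1 (r ^ 2), by positivity, fun a ha y => ?_⟩
  by_cases hy : |y| ≤ r
  · have h₁ : |y| ≤ δ := by nlinarith
    have h₂ : |a * y| ≤ δ := by
      rw [abs_mul]
      have := mul_le_mul ha hy (abs_nonneg y) hA
      nlinarith
    rw [hid y h₁, hid _ h₂, sub_self, abs_zero]
    positivity
  · have hry : r ^ 2 ≤ y ^ 2 := by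
      rw [← sq_abs y]
      exact pow_le_pow_left₀ hr.le (not_le.mp hy).le 2
    have hbound : |τ (a * y) - a * τ y| ≤ B * (1 + A) + 1 := by
      have h₁ := abs_sub (τ (a * y)) (a * τ y)
      have h₂ : |a * τ y| ≤ A * B := by
        rw [abs_mul]
        exact mul_le_mul ha (hB y) (abs_nonneg _) hA
      linarith [hB (a * y)]
    calc |τ (a * y) - a * τ y| ≤ B * (1 + A) + 1 := hbound
      _ = (B * (1 + A) + 1) / min 1 (r ^ 2) * min 1 (r ^ 2) := by field_simp
      _ ≤ (B * (1 + A) + 1) / min 1 (r ^ 2) * min 1 (y ^ 2) := by gcongr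

/-- Integrability of `min 1 (y ^ 2)` is preserved by rescaling the variable. -/
theorem integrable_min_one_mul_sq {K : Measure ℝ}
    (hK : Integrable (fun y : ℝ => min 1 (y ^ 2)) K) (a : ℝ) :
    Integrable (fun y : ℝ => min 1 ((a * y) ^ 2)) K := by
  refine (hK.const_mul (1 + a ^ 2)).mono' (by fun_prop) (.of_forall fun y => ?_)
  rw [Real.norm_of_nonneg (by positivity), mul_pow]
  rcases le_total 1 (y ^ 2) with h | h
  · rw [min_eq_left h]
    nlinarith [min_le_left 1 (a ^ 2 * y ^ 2), sq_nonneg a]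
  · rw [min_eq_right h]
    nlinarith [min_le_right 1 (a ^ 2 * y ^ 2), sq_nonneg y]

/-- For every truncation function `τ` (a bounded measurable function that is
the identity near zero) there is a constant `κ > 0` such that for every Borel measure `K`
on `ℝ` with `∫ min(1, y²) K(dy) < ∞`, all reals `b, a` and every `c ∈ [-1, 1]`,
`|c·a·b + ∫ (τ(c·a·y) − c·a·τ(y)) K(dy)|
  ≤ |a·b + ∫ (τ(a·y) − a·τ(y)) K(dy)| + κ · ∫ min(1, (a·y)²) K(dy)`. -/
theorem truncation_sup_bound
    (τ : ℝ → ℝ) (hτ_meas : Measurable τ)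
    (hτ_bdd : ∃ B : ℝ, ∀ u : ℝ, |τ u| ≤ B)
    (hτ_id : ∃ δ > (0 : ℝ), ∀ u : ℝ, |u| ≤ δ → τ u = u) :
    ∃ κ > (0 : ℝ), ∀ (K : Measure ℝ),
      Integrable (fun y : ℝ => min 1 (y ^ 2)) K →
      ∀ (b a : ℝ), ∀ c ∈ Set.Icc (-1 : ℝ) 1,
        |c * a * b + ∫ y, (τ (c * a * y) - c * a * τ y) ∂K|
          ≤ |a * b + ∫ y, (τ (a * y) - a * τ y) ∂K|
            + κ * ∫ y, min 1 ((a * y) ^ 2) ∂K := by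
  obtain ⟨κ, hκ, hκ_le⟩ := exists_abs_truncation_mul_sub_le τ hτ_bdd hτ_id 1 zero_le_one
  refine ⟨κ, hκ, fun K hK b a c hc => ?_⟩
  have hc1 : |c| ≤ 1 := abs_le.mpr hc
  obtain ⟨C, -, hC⟩ := exists_abs_truncation_mul_sub_le τ hτ_bdd hτ_id |a| (abs_nonneg a)
  have hf : Integrable (fun y => τ (a * y) - a * τ y) K :=
    (hK.const_mul C).mono' (by fun_prop) (.of_forall fun y => hC a le_rfl y)
  have hmin := (integrable_min_one_mul_sq hK a).const_mul κ
  have hg : Integrable (fun y => τ (c * (a * y)) - c * τ (a * y)) K :=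
    hmin.mono' (by fun_prop) (.of_forall fun y => hκ_le c hc1 (a * y))
  have hg_le : |∫ y, (τ (c * (a * y)) - c * τ (a * y)) ∂K|
      ≤ κ * ∫ y, min 1 ((a * y) ^ 2) ∂K := by
    rw [← integral_const_mul]
    exact norm_integral_le_of_norm_le (f := fun y => τ (c * (a * y)) - c * τ (a * y)) hmin
      (.of_forall fun y => hκ_le c hc1 (a * y))
  have hsplit : ∫ y, (τ (c * a * y) - c * a * τ y) ∂K
      = c * ∫ y, (τ (a * y) - a * τ y) ∂K
        + ∫ y, (τ (c * (a * y)) - c * τ (a * y)) ∂K := by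
    rw [← integral_const_mul, ← integral_add (hf.const_mul c) hg]
    congr 1 with y
    rw [mul_assoc c a y]
    ring
  rw [hsplit, ← add_assoc, mul_assoc, ← mul_add]
  refine (abs_add_le _ _).trans (add_le_add ?_ hg_le)
  rw [abs_mul]
  exact mul_le_of_le_one_left (abs_nonneg _) hc1
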